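/- arXiv:2303.04123 — 4 statements merged into one kernel-verified Lean document; each statement's English description precedes it below -/
import Mathlib

section
/- Consider cases 1 and 2 of the private FL scheme with within-segment permutations. For every realization y = (y_1, …, y_B) of Y with ℙ(Y = y) > 0 and every realization x = (x_1, …, x_B) of X, the conditional probability satisfies: ℙ(X = x | Y = y) = ℙ(X = x) / ℙ(|X_1| = |y_1|, …, |X_B| = |y_B|) if |x_i| = |y_i| for all i = 1, …, B, and ℙ(X = x | Y = y) = 0 otherwise. -/
open scoped BigOperators
open scoped Classical

noncomputable section

/-- Probability of an event on a finite probability space with weights `p`. -/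
def pr {Ω : Type*} [Fintype Ω] (p : Ω → ℝ) (E : Ω → Prop) : ℝ :=
  ∑ ω, if E ω then p ω else 0

/-- Distribution (pmf) of a finitely valued random variable. -/
def dist {Ω S : Type*} [Fintype Ω] (p : Ω → ℝ) (X : Ω → S) (s : S) : ℝ :=
  pr p (fun ω => X ω = s)

/-- Shannon entropy of a finitely valued random variable. -/
def entropy {Ω S : Type*} [Fintype Ω] (p : Ω → ℝ) (X : Ω → S) : ℝ :=
  ∑ s ∈ Finset.univ.image X, Real.negMulLog (dist p X s)

/-- Joint entropy of a pair of random variables. -/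
def entropy2 {Ω S T : Type*} [Fintype Ω] (p : Ω → ℝ) (X : Ω → S) (Y : Ω → T) : ℝ :=
  entropy p (fun ω => (X ω, Y ω))

/-- Mutual information `I(X;Y) = H(X) + H(Y) - H(X,Y)`. -/
def mutualInfo {Ω S T : Type*} [Fintype Ω] (p : Ω → ℝ) (X : Ω → S) (Y : Ω → T) : ℝ :=
  entropy p X + entropy p Y - entropy2 p X Y

/-- Conditional entropy `H(X|Y) = H(X,Y) - H(Y)`. -/
def condEntropy {Ω S T : Type*} [Fintype Ω] (p : Ω → ℝ) (X : Ω → S) (Y : Ω → T) : ℝ :=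
  entropy2 p X Y - entropy p Y

/-- Law of total probability. -/
lemma sum_pr_and {Ω S : Type*} [Fintype Ω] [Fintype S] (p : Ω → ℝ) (X : Ω → S)
    (E : Ω → Prop) : ∑ a, pr p (fun ω => X ω = a ∧ E ω) = pr p E := by
  unfold pr
  rw [Finset.sum_comm]
  refine Finset.sum_congr rfl fun ω _ => ?_
  rw [Finset.sum_eq_single (X ω)]
  · simp
  · intro a _ ha
    simp [ha.symm]
  · simp

lemma pr_congr {Ω : Type*} [Fintype Ω] (p : Ω → ℝ) {E F : Ω → Prop}
    (h : ∀ ω, E ω ↔ F ω) : pr p E = pr p F := by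
  rw [funext fun ω => propext (h ω)]

/-- The probability of an event intersected with a deterministic condition. -/
lemma pr_and_const {Ω : Type*} [Fintype Ω] (p : Ω → ℝ) (E : Ω → Prop) (c : Prop) :
    pr p (fun ω => E ω ∧ c) = if c then pr p E else 0 := by
  by_cases hc : c <;> simp [pr, hc]

/-- Finite sets of equal cardinality are related by a permutation. -/
lemma exists_perm_image_eq {α : Type*} [Fintype α] [DecidableEq α] {s t : Finset α}
    (h : s.card = t.card) : ∃ σ : Equiv.Perm α, s.image σ = t := by
  let e : {a // a ∈ s} ≃ {a // a ∈ t} := Finset.equivOfCardEq h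
  refine ⟨e.extendSubtype, Finset.eq_of_subset_of_card_le ?_ ?_⟩
  · intro b hb
    obtain ⟨a, ha, rfl⟩ := Finset.mem_image.mp hb
    exact e.extendSubtype_mem a ha
  · rw [Finset.card_image_of_injective _ (Equiv.injective _), h]

/-- The number of families of permutations whose inverses carry `x` to `y`. -/
def permCount {ι α : Type*} [Fintype ι] [Fintype α] [DecidableEq α]
    (x y : ι → Finset α) : ℕ :=
  (Finset.univ.filter fun g : ι → Equiv.Perm α =>
    ∀ i, (x i).image ⇑(g i)⁻¹ = y i).card

lemma permCount_eq {ι α : Type*} [Fintype ι] [Fintype α] [DecidableEq α]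
    (x y : ι → Finset α) :
    permCount x y = if ∀ i, (x i).card = (y i).card then permCount y y else 0 := by
  split_ifs with h
  · choose σ hσ using fun i => exists_perm_image_eq (h i).symm
    refine Finset.card_equiv (Equiv.mulLeft σ⁻¹) fun g => ?_
    simp only [Finset.mem_filter, Finset.mem_univ, true_and, Equiv.coe_mulLeft]
    refine forall_congr' fun i => ?_
    rw [← hσ i, Finset.image_image]
    simp only [Pi.mul_apply, Pi.inv_apply, mul_inv_rev, inv_inv, Equiv.Perm.coe_mul]
  · refine Finset.card_eq_zero.mpr (Finset.filter_eq_empty_iff.mpr fun g _ hg => h fun i => ?_)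
    rw [← hg i, Finset.card_image_of_injective _ (Equiv.injective _)]

/-- With only within-segment permutations (cases 1 and 2), for every
realization `y` of `Y` with `ℙ(Y = y) > 0` and every realization `x` of `X`,
`ℙ(X = x | Y = y) = ℙ(X = x) / ℙ(|X_1| = |y_1|, …, |X_B| = |y_B|)` if `|x_i| = |y_i|`
for all `i`, and `0` otherwise. -/
theorem conditional_probability_within_segment
    {Ω : Type*} [Fintype Ω] (p : Ω → ℝ)
    (hp0 : ∀ ω, 0 ≤ p ω) (hp1 : ∑ ω, p ω = 1)
    (B m s : ℕ) (hB : 0 < B) (hm : 0 < m) (hs : s ≤ B * m)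
    (X : Ω → Fin B → Finset (Fin m))
    (hXs : ∀ ω, p ω ≠ 0 → ∑ i, (X ω i).card = s)
    (π : Fin B → Ω → Equiv.Perm (Fin m))
    (hπunif : ∀ i g, dist p (π i) g = (Fintype.card (Equiv.Perm (Fin m)) : ℝ)⁻¹)
    (hindep : ∀ (x : Fin B → Finset (Fin m)) (g : Fin B → Equiv.Perm (Fin m)),
      pr p (fun ω => X ω = x ∧ ∀ i, π i ω = g i)
        = dist p X x * ∏ i, dist p (π i) (g i))
    (Y : Ω → Fin B → Finset (Fin m))
    (hY : ∀ ω i, Y ω i = (X ω i).image ⇑(π i ω)⁻¹) :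
    ∀ (y : Fin B → Finset (Fin m)), 0 < pr p (fun ω => Y ω = y) →
      ∀ (x : Fin B → Finset (Fin m)),
        pr p (fun ω => X ω = x ∧ Y ω = y) / pr p (fun ω => Y ω = y)
          = if ∀ i, (x i).card = (y i).card
            then dist p X x / pr p (fun ω => ∀ i, (X ω i).card = (y i).card)
            else 0 := by
  intro y hy x
  set c : ℝ := ∏ _i : Fin B, (Fintype.card (Equiv.Perm (Fin m)) : ℝ)⁻¹ with hc
  have joint (x : Fin B → Finset (Fin m)) : pr p (fun ω => X ω = x ∧ Y ω = y)
      = if ∀ i, (x i).card = (y i).card then c * permCount y y * dist p X x else 0 := by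
    have hg (g : Fin B → Equiv.Perm (Fin m)) :
        pr p (fun ω => (fun i => π i ω) = g ∧ X ω = x ∧ Y ω = y)
          = if ∀ i, (x i).image ⇑(g i)⁻¹ = y i then dist p X x * c else 0 := by
      have hE : pr p (fun ω => (fun i => π i ω) = g ∧ X ω = x ∧ Y ω = y)
          = pr p (fun ω => (X ω = x ∧ ∀ i, π i ω = g i) ∧
              ∀ i, (x i).image ⇑(g i)⁻¹ = y i) := by
        refine pr_congr p fun ω => ?_
        constructor
        · rintro ⟨rfl, rfl, h⟩
          exact ⟨⟨rfl, fun _ => rfl⟩, fun i => by rw [← hY, h]⟩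
        · rintro ⟨⟨rfl, h⟩, h'⟩
          exact ⟨funext h, rfl, funext fun i => by rw [hY, h, h']⟩
      rw [hE, pr_and_const, hindep]
      simp only [hπunif, hc]
    rw [← sum_pr_and p (fun ω i => π i ω)]
    simp only [hg]
    rw [← Finset.sum_filter, Finset.sum_const, nsmul_eq_mul]
    have hcard : (Finset.univ.filter fun g : Fin B → Equiv.Perm (Fin m) =>
        ∀ i, (x i).image ⇑(g i)⁻¹ = y i).card = permCount x y := by
      unfold permCount
      congr!
    rw [hcard, permCount_eq]
    split_ifs
    · ring
    · simp
  have marginal : pr p (fun ω => Y ω = y)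
      = c * permCount y y * pr p (fun ω => ∀ i, (X ω i).card = (y i).card) := by
    rw [← sum_pr_and p X, ← sum_pr_and p X, Finset.mul_sum]
    refine Finset.sum_congr rfl fun x _ => ?_
    have hE : pr p (fun ω => X ω = x ∧ ∀ i, (X ω i).card = (y i).card)
        = pr p (fun ω => X ω = x ∧ ∀ i, (x i).card = (y i).card) := by
      refine pr_congr p fun ω => and_congr_right ?_
      rintro rfl
      rfl
    rw [joint, hE, pr_and_const, mul_ite, mul_zero]
    unfold _root_.dist
    congr
  rw [joint, ite_div, zero_div]
  rw [marginal] at hy ⊢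
  rw [mul_div_mul_left _ _ (left_ne_zero_of_mul hy.ne')]
end
end

section
/- Consider cases 1 and 2 of the private FL scheme with within-segment permutations. The conditional entropy of the real sparse index sets given the permuted sparse index sets satisfies: H(X | Y) = H(X) − H(N_1, …, N_B), where (N_1, …, N_B) is the vector of per-segment counts of sparse subpackets. -/
open scoped BigOperators
open scoped Classical

noncomputable section

theorem entropy_eq_neg_sum_mul_log {Ω S : Type*} [Fintype Ω] (p : Ω → ℝ) (X : Ω → S) :
    entropy p X = -∑ ω, p ω * Real.log (dist p X (X ω)) := by
  unfold entropy
  rw [← Finset.sum_fiberwise_of_maps_to (s := Finset.univ) (t := Finset.univ.image X) (g := X)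
    (fun ω _ => Finset.mem_image_of_mem _ (Finset.mem_univ ω)), ← Finset.sum_neg_distrib]
  refine Finset.sum_congr rfl fun s _ => ?_
  have h : ∑ ω with X ω = s, p ω * Real.log (dist p X (X ω))
      = ∑ ω with X ω = s, p ω * Real.log (dist p X s) := by
    refine Finset.sum_congr rfl fun ω hω => ?_
    rw [(Finset.mem_filter.1 hω).2]
  have hd : ∑ ω with X ω = s, p ω = dist p X s := by
    rw [_root_.dist, pr, Finset.sum_filter]
  rw [h, ← Finset.sum_mul, hd, Real.negMulLog, neg_mul]

theorem le_dist_self {Ω S : Type*} [Fintype Ω] {p : Ω → ℝ} (hp0 : ∀ ω, 0 ≤ p ω)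
    (X : Ω → S) (ω : Ω) : p ω ≤ dist p X (X ω) := by
  have h := Finset.single_le_sum (f := fun ω' => if X ω' = X ω then p ω' else 0)
    (s := Finset.univ) (fun ω' _ => by split_ifs <;> simp [hp0]) (Finset.mem_univ ω)
  simpa [_root_.dist, pr] using h

/-- The probability that a uniform permutation `g` maps `b` onto `a`. -/
def permKernel {α : Type*} [Fintype α] [DecidableEq α] (a b : Finset α) : ℝ :=
  ∑ _g ∈ Finset.univ.filter fun g : Equiv.Perm α => a.image ⇑g⁻¹ = b,
    (Fintype.card (Equiv.Perm α) : ℝ)⁻¹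

theorem permKernel_self_pos {α : Type*} [Fintype α] [DecidableEq α] (a : Finset α) : 0 < permKernel a a := by
  refine Finset.sum_pos (fun _ _ => inv_pos.2 (Nat.cast_pos.2 Fintype.card_pos)) ⟨1, ?_⟩
  rw [Finset.mem_filter, inv_one, Equiv.Perm.coe_one, Finset.image_id]
  exact ⟨Finset.mem_univ _, rfl⟩

theorem exists_perm_image_eq_s3 {α : Type*} [Fintype α] [DecidableEq α] {a b : Finset α} (h : a.card = b.card) :
    ∃ g : Equiv.Perm α, b.image ⇑g = a := by
  let e : {x // x ∈ b} ≃ {x // x ∈ a} := Finset.equivOfCardEq h.symm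
  refine ⟨e.extendSubtype, Finset.eq_of_subset_of_card_le ?_ ?_⟩
  · intro x hx
    obtain ⟨y, hy, rfl⟩ := Finset.mem_image.1 hx
    exact e.extendSubtype_mem y hy
  · rw [Finset.card_image_of_injective _ (Equiv.injective _), h]

theorem permKernel_eq_self {α : Type*} [Fintype α] [DecidableEq α] {a b : Finset α} (h : a.card = b.card) :
    permKernel a b = permKernel b b := by
  obtain ⟨k, rfl⟩ := exists_perm_image_eq_s3 h
  refine Finset.sum_equiv (Equiv.mulLeft k⁻¹) (fun g => ?_) fun _ _ => rfl
  simp only [Finset.mem_filter, Finset.mem_univ, true_and, Equiv.coe_mulLeft, mul_inv_rev,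
    inv_inv, Equiv.Perm.coe_mul, Finset.image_image]

theorem permKernel_eq_zero {α : Type*} [Fintype α] [DecidableEq α] {a b : Finset α} (h : a.card ≠ b.card) :
    permKernel a b = 0 := by
  rw [permKernel, Finset.filter_false_of_mem, Finset.sum_empty]
  rintro g - rfl
  exact h (Finset.card_image_of_injective _ (Equiv.injective _)).symm

theorem dist_eq_sum_dist_prod {Ω S T : Type*} [Fintype Ω] [Fintype S] (p : Ω → ℝ)
    (X : Ω → S) (Y : Ω → T) (y : T) :
    dist p Y y = ∑ x, dist p (fun ω => (X ω, Y ω)) (x, y) := by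
  simp only [_root_.dist, pr, Prod.mk.injEq]
  rw [Finset.sum_comm]
  refine Finset.sum_congr rfl fun ω _ => ?_
  simp [ite_and]

theorem dist_comp_eq_sum {Ω S T : Type*} [Fintype Ω] [Fintype S] (p : Ω → ℝ)
    (X : Ω → S) (f : S → T) (t : T) :
    dist p (fun ω => f (X ω)) t = ∑ x, if f x = t then dist p X x else 0 := by
  rw [dist_eq_sum_dist_prod p X]
  refine Finset.sum_congr rfl fun x _ => ?_
  simp only [_root_.dist, pr, Prod.mk.injEq]
  split_ifs with h
  · refine Finset.sum_congr rfl fun ω _ => if_congr ⟨And.left, ?_⟩ rfl rfl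
    rintro rfl
    exact ⟨rfl, h⟩
  · refine Finset.sum_eq_zero fun ω _ => if_neg ?_
    rintro ⟨rfl, h'⟩
    exact h h'

section WithinSegment

variable {Ω ι α : Type*} [Fintype Ω] [Fintype ι] [Fintype α] [DecidableEq α] {p : Ω → ℝ}
  {X : Ω → ι → Finset α} {π : ι → Ω → Equiv.Perm α} {Y : Ω → ι → Finset α}

theorem dist_permuted_pair
    (hπunif : ∀ i g, dist p (π i) g = (Fintype.card (Equiv.Perm α) : ℝ)⁻¹)
    (hindep : ∀ (x : ι → Finset α) (g : ι → Equiv.Perm α),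
      pr p (fun ω => X ω = x ∧ ∀ i, π i ω = g i) = dist p X x * ∏ i, dist p (π i) (g i))
    (hY : ∀ ω i, Y ω i = (X ω i).image ⇑(π i ω)⁻¹) (x y : ι → Finset α) :
    dist p (fun ω => (X ω, Y ω)) (x, y) = dist p X x * ∏ i, permKernel (x i) (y i) := by
  have hsum : dist p (fun ω => (X ω, Y ω)) (x, y)
      = ∑ g ∈ Fintype.piFinset
          (fun i => Finset.univ.filter fun g : Equiv.Perm α => (x i).image ⇑g⁻¹ = y i),
        pr p (fun ω => X ω = x ∧ ∀ i, π i ω = g i) := by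
    simp only [_root_.dist, pr, Prod.mk.injEq]
    rw [Finset.sum_comm]
    refine Finset.sum_congr rfl fun ω _ => ?_
    simp only [← funext_iff (f := fun i => π i ω), ite_and]
    by_cases hx : X ω = x
    · subst hx
      simp [funext_iff (f := Y ω), hY]
    · simp [hx]
  rw [hsum]
  simp only [hindep, hπunif, permKernel]
  rw [Finset.prod_univ_sum, Finset.mul_sum]

theorem dist_permuted
    (hπunif : ∀ i g, dist p (π i) g = (Fintype.card (Equiv.Perm α) : ℝ)⁻¹)
    (hindep : ∀ (x : ι → Finset α) (g : ι → Equiv.Perm α),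
      pr p (fun ω => X ω = x ∧ ∀ i, π i ω = g i) = dist p X x * ∏ i, dist p (π i) (g i))
    (hY : ∀ ω i, Y ω i = (X ω i).image ⇑(π i ω)⁻¹) (y : ι → Finset α) :
    dist p Y y = dist p (fun ω i => (X ω i).card) (fun i => (y i).card)
      * ∏ i, permKernel (y i) (y i) := by
  rw [dist_eq_sum_dist_prod p X, dist_comp_eq_sum p X (fun x i => (x i).card), Finset.sum_mul]
  refine Finset.sum_congr rfl fun x _ => ?_
  rw [dist_permuted_pair hπunif hindep hY]
  split_ifs with h
  · simp only [permKernel_eq_self (congrFun h _)]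
  · obtain ⟨i, hi⟩ := Function.ne_iff.1 h
    rw [Finset.prod_eq_zero (Finset.mem_univ i) (permKernel_eq_zero hi), mul_zero, zero_mul]

end WithinSegment

/-- With only within-segment permutations (cases 1 and 2), the
conditional entropy of the real sparse index sets given the permuted index sets
satisfies `H(X | Y) = H(X) − H(|X_1|, …, |X_B|)`. -/
theorem conditional_entropy_within_segment
    {Ω : Type*} [Fintype Ω] (p : Ω → ℝ)
    (hp0 : ∀ ω, 0 ≤ p ω) (hp1 : ∑ ω, p ω = 1)
    (B m s : ℕ) (hB : 0 < B) (hm : 0 < m) (hs : s ≤ B * m)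
    (X : Ω → Fin B → Finset (Fin m))
    (hXs : ∀ ω, p ω ≠ 0 → ∑ i, (X ω i).card = s)
    (π : Fin B → Ω → Equiv.Perm (Fin m))
    (hπunif : ∀ i g, dist p (π i) g = (Fintype.card (Equiv.Perm (Fin m)) : ℝ)⁻¹)
    (hindep : ∀ (x : Fin B → Finset (Fin m)) (g : Fin B → Equiv.Perm (Fin m)),
      pr p (fun ω => X ω = x ∧ ∀ i, π i ω = g i)
        = dist p X x * ∏ i, dist p (π i) (g i))
    (Y : Ω → Fin B → Finset (Fin m))
    (hY : ∀ ω i, Y ω i = (X ω i).image ⇑(π i ω)⁻¹) :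
    condEntropy p X Y = entropy p X - entropy p (fun ω => fun i => (X ω i).card) := by
  simp only [condEntropy, entropy2, entropy_eq_neg_sum_mul_log, neg_sub_neg,
    ← Finset.sum_sub_distrib, ← mul_sub]
  refine Finset.sum_congr rfl fun ω _ => ?_
  rcases (hp0 ω).eq_or_lt with h0 | h0
  · simp [← h0]
  have hcard : ∀ i, (X ω i).card = (Y ω i).card := fun i => by
    rw [hY, Finset.card_image_of_injective _ (Equiv.injective _)]
  have hXpos : dist p X (X ω) ≠ 0 := (h0.trans_le (le_dist_self hp0 X ω)).ne'
  have hNpos : dist p (fun ω i => (X ω i).card) (fun i => (X ω i).card) ≠ 0 :=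
    (h0.trans_le (le_dist_self hp0 (fun ω i => (X ω i).card) ω)).ne'
  have hK : ∏ i, permKernel (Y ω i) (Y ω i) ≠ 0 :=
    (Finset.prod_pos fun i _ => permKernel_self_pos _).ne'
  rw [dist_permuted_pair hπunif hindep hY, dist_permuted hπunif hindep hY]
  simp only [permKernel_eq_self (hcard _), ← hcard]
  simp only [hcard] at hNpos ⊢
  rw [Real.log_mul hXpos hK, Real.log_mul hNpos hK]
  ring
end
end

section
/- Consider cases 3 and 4 of the private FL scheme with both within-segment and inter-segment permutations. For every realization y = (y_1, …, y_B) of Y with ℙ(Y = y) > 0 and every realization x = (x_1, …, x_B) of X, the conditional probability satisfies: ℙ(X = x | Y = y) = ℙ(X = x) / ℙ(M = {|y_1|, …, |y_B|}) if the multiset {|x_1|, …, |x_B|} equals the multiset {|y_1|, …, |y_B|}, and ℙ(X = x | Y = y) = 0 otherwise, where M denotes the random multiset {|X_1|, …, |X_B|}. -/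
open scoped BigOperators
open scoped Classical

noncomputable section

/-- Law of total probability along a finitely valued random variable. -/
lemma pr_eq_sum_fiber {Ω S : Type*} [Fintype Ω] [Fintype S] (p : Ω → ℝ) (E : Ω → Prop)
    (Z : Ω → S) : pr p E = ∑ z, pr p (fun ω => E ω ∧ Z ω = z) := by
  unfold pr
  rw [Finset.sum_comm]
  refine Finset.sum_congr rfl fun ω _ => ?_
  by_cases h : E ω <;> simp [h]

lemma pr_and_eq_ite {Ω : Type*} [Fintype Ω] (p : Ω → ℝ) (E : Ω → Prop) (R : Prop) :
    pr p (fun ω => R ∧ E ω) = if R then pr p E else 0 := by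
  unfold pr
  by_cases h : R <;> simp [h]

lemma map_univ_val_eq_iff_exists_perm {α β : Type*} [Fintype α] (f g : α → β) :
    Multiset.map f Finset.univ.val = Multiset.map g Finset.univ.val
      ↔ ∃ ρ : Equiv.Perm α, f = g ∘ ρ := by
  refine ⟨fun h => ?_, ?_⟩
  · have e (c : β) : Nonempty ({a // f a = c} ≃ {a // g a = c}) := by
      refine ⟨Fintype.equivOfCardEq ?_⟩
      have hc := congrArg (Multiset.count c) h
      simp only [Multiset.count_map, eq_comm (a := c)] at hc
      rw [Fintype.card_subtype, Fintype.card_subtype]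
      exact hc
    exact ⟨Equiv.ofFiberEquiv fun c => (e c).some,
      funext fun a => (Equiv.ofFiberEquiv_map _ a).symm⟩
  · rintro ⟨ρ, rfl⟩
    rw [← Multiset.map_map, Multiset.map_univ_val_equiv]

/-- Number of pairs of within-segment and inter-segment permutations sending `x` to `y`. -/
def shuffleCount {B m : ℕ} (x y : Fin B → Finset (Fin m)) : ℝ :=
  ∑ q : (Fin B → Equiv.Perm (Fin m)) × Equiv.Perm (Fin B),
    if ∀ j, (x (q.2 j)).image ⇑(q.1 (q.2 j))⁻¹ = y j then 1 else 0

lemma shuffleCount_eq_zero {B m : ℕ} {x y : Fin B → Finset (Fin m)}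
    (h : Multiset.map (fun i => (x i).card) Finset.univ.val
      ≠ Multiset.map (fun i => (y i).card) Finset.univ.val) : shuffleCount x y = 0 := by
  refine Finset.sum_eq_zero fun q _ => if_neg fun hq => h ?_
  refine (map_univ_val_eq_iff_exists_perm _ _).2 ⟨q.2⁻¹, funext fun i => ?_⟩
  simp [← hq, Finset.card_image_of_injective _ (Equiv.injective _)]

lemma shuffleCount_eq_self {B m : ℕ} {x y : Fin B → Finset (Fin m)}
    (h : Multiset.map (fun i => (x i).card) Finset.univ.val
      = Multiset.map (fun i => (y i).card) Finset.univ.val) :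
    shuffleCount x y = shuffleCount y y := by
  obtain ⟨ρ, hρ⟩ := (map_univ_val_eq_iff_exists_perm _ _).1 h
  choose g hg using fun i => Equiv.Perm.exists_map_finset_eq _ _ (congrFun hρ i).symm
  refine Fintype.sum_equiv
    (Equiv.prodCongr
      ((Equiv.piCongrRight fun i => Equiv.mulLeft (g i)⁻¹).trans
        (Equiv.arrowCongr ρ (Equiv.refl _)))
      (Equiv.mulLeft ρ)) _ _ fun q => ?_
  congr 1
  refine propext (forall_congr' fun j => ?_)
  rw [← hg]
  simp [Finset.map_eq_image, Finset.image_image, Equiv.Perm.coe_mul]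

/-- With both within-segment and inter-segment permutations
(cases 3 and 4), for every realization `y` of `Y` with `ℙ(Y = y) > 0` and every
realization `x` of `X`, `ℙ(X = x | Y = y) = ℙ(X = x) / ℙ(M = {|y_1|, …, |y_B|})`
if the multiset `{|x_1|, …, |x_B|}` equals `{|y_1|, …, |y_B|}`, and `0` otherwise,
where `M = {|X_1|, …, |X_B|}`. -/
theorem conditional_probability_two_stage
    {Ω : Type*} [Fintype Ω] (p : Ω → ℝ)
    (hp0 : ∀ ω, 0 ≤ p ω) (hp1 : ∑ ω, p ω = 1)
    (B m s : ℕ) (hB : 0 < B) (hm : 0 < m) (hs : s ≤ B * m)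
    (X : Ω → Fin B → Finset (Fin m))
    (hXs : ∀ ω, p ω ≠ 0 → ∑ i, (X ω i).card = s)
    (π : Fin B → Ω → Equiv.Perm (Fin m))
    (σ : Ω → Equiv.Perm (Fin B))
    (hπunif : ∀ i g, dist p (π i) g = (Fintype.card (Equiv.Perm (Fin m)) : ℝ)⁻¹)
    (hσunif : ∀ τ, dist p σ τ = (Fintype.card (Equiv.Perm (Fin B)) : ℝ)⁻¹)
    (hindep : ∀ (x : Fin B → Finset (Fin m)) (g : Fin B → Equiv.Perm (Fin m))
        (τ : Equiv.Perm (Fin B)),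
      pr p (fun ω => X ω = x ∧ (∀ i, π i ω = g i) ∧ σ ω = τ)
        = dist p X x * (∏ i, dist p (π i) (g i)) * dist p σ τ)
    (Y : Ω → Fin B → Finset (Fin m))
    (hY : ∀ ω j, Y ω j = (X ω (σ ω j)).image ⇑(π (σ ω j) ω)⁻¹) :
    ∀ (y : Fin B → Finset (Fin m)), 0 < pr p (fun ω => Y ω = y) →
      ∀ (x : Fin B → Finset (Fin m)),
        pr p (fun ω => X ω = x ∧ Y ω = y) / pr p (fun ω => Y ω = y)
          = if Multiset.map (fun i => (x i).card) Finset.univ.val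
                = Multiset.map (fun i => (y i).card) Finset.univ.val
            then dist p X x
                  / pr p (fun ω => Multiset.map (fun i => (X ω i).card) Finset.univ.val
                      = Multiset.map (fun i => (y i).card) Finset.univ.val)
            else 0 := by
  intro y hy x
  set c : ℝ := (∏ _i : Fin B, (Fintype.card (Equiv.Perm (Fin m)) : ℝ)⁻¹)
    * (Fintype.card (Equiv.Perm (Fin B)) : ℝ)⁻¹
  have joint (x : Fin B → Finset (Fin m)) :
      pr p (fun ω => X ω = x ∧ Y ω = y) = dist p X x * (c * shuffleCount x y) := by
    rw [pr_eq_sum_fiber p _ fun ω => ((fun i => π i ω, σ ω) :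
      (Fin B → Equiv.Perm (Fin m)) × Equiv.Perm (Fin B)), shuffleCount, Finset.mul_sum,
      Finset.mul_sum]
    refine Finset.sum_congr rfl fun q _ => ?_
    have hev : (fun ω => (X ω = x ∧ Y ω = y) ∧ ((fun i => π i ω, σ ω) :
        (Fin B → Equiv.Perm (Fin m)) × Equiv.Perm (Fin B)) = q)
        = fun ω => (∀ j, (x (q.2 j)).image ⇑(q.1 (q.2 j))⁻¹ = y j) ∧
          (X ω = x ∧ (∀ i, π i ω = q.1 i) ∧ σ ω = q.2) := by
      funext ω
      refine propext ⟨?_, ?_⟩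
      · rintro ⟨⟨rfl, rfl⟩, rfl⟩
        exact ⟨fun j => (hY ω j).symm, rfl, fun _ => rfl, rfl⟩
      · rintro ⟨hq, rfl, hπ, hσ⟩
        refine ⟨⟨rfl, funext fun j => ?_⟩, Prod.ext (funext hπ) hσ⟩
        rw [hY, hσ, hπ, hq]
    rw [hev, pr_and_eq_ite, hindep]
    simp only [hπunif, hσunif, mul_ite, mul_one, mul_zero, c, mul_assoc]
  have marginal : pr p (fun ω => Y ω = y)
      = pr p (fun ω => Multiset.map (fun i => (X ω i).card) Finset.univ.val
          = Multiset.map (fun i => (y i).card) Finset.univ.val) * (c * shuffleCount y y) := by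
    rw [pr_eq_sum_fiber p _ X, pr_eq_sum_fiber p (fun ω => Multiset.map _ _ = _) X,
      Finset.sum_mul]
    refine Finset.sum_congr rfl fun z _ => ?_
    have hev : (fun ω => Multiset.map (fun i => (X ω i).card) Finset.univ.val
          = Multiset.map (fun i => (y i).card) Finset.univ.val ∧ X ω = z)
        = fun ω => Multiset.map (fun i => (z i).card) Finset.univ.val
          = Multiset.map (fun i => (y i).card) Finset.univ.val ∧ X ω = z := by
      funext ω
      refine propext (and_congr_left ?_)
      rintro rfl
      rfl
    simp only [and_comm (a := Y _ = y)]
    rw [joint, hev, pr_and_eq_ite]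
    split_ifs with h
    · rw [shuffleCount_eq_self h, _root_.dist]
    · rw [shuffleCount_eq_zero h, mul_zero, mul_zero, zero_mul]
  rw [marginal] at hy
  rw [joint, marginal]
  split_ifs with h
  · rw [shuffleCount_eq_self h, mul_div_mul_right _ _ (right_ne_zero_of_mul hy.ne')]
  · rw [shuffleCount_eq_zero h, mul_zero, mul_zero, zero_div]
end
end

section
/- Consider cases 3 and 4 of the private FL scheme with both within-segment and inter-segment permutations. The conditional entropy of the real sparse index sets given the permuted sparse index sets satisfies: H(X | Y) = H(X) − H(M), where M is the random multiset {N_1, …, N_B} of per-segment counts. -/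
open scoped BigOperators
open scoped Classical

noncomputable section

section Entropy

theorem negMulLog_inv (x : ℝ) : Real.negMulLog x⁻¹ = x⁻¹ * Real.log x := by
  rw [Real.negMulLog, Real.log_inv, neg_mul_neg]

variable {Ω S T : Type*} [Fintype Ω] (p : Ω → ℝ)

theorem dist_eq_zero_of_forall_ne (X : Ω → S) (x : S) (h : ∀ ω, X ω ≠ x) : dist p X x = 0 := by
  simp [_root_.dist, pr, h]

theorem entropy_eq_sum_of_forall_mem (X : Ω → S) (A : Finset S) (hA : ∀ ω, X ω ∈ A) :
    entropy p X = ∑ x ∈ A, Real.negMulLog (dist p X x) := by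
  refine Finset.sum_subset (fun x hx => ?_) fun x _ hx => ?_
  · obtain ⟨ω, -, rfl⟩ := Finset.mem_image.1 hx
    exact hA ω
  · rw [dist_eq_zero_of_forall_ne p X x fun ω h => hx (by simp [← h]), Real.negMulLog_zero]

theorem dist_comp [Fintype S] (X : Ω → S) (f : S → T) (t : T) :
    dist p (fun ω => f (X ω)) t = ∑ x, if f x = t then dist p X x else 0 := by
  simp only [_root_.dist, pr, ← Finset.sum_filter (p := fun x => f x = t)]
  rw [Finset.sum_comm]
  refine Finset.sum_congr rfl fun ω _ => ?_
  simp [Finset.sum_ite_eq]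

/-- The number of points with the same value of `f` as a given point. -/
def fiberCard [Fintype S] (f : S → T) (t : T) : ℕ :=
  (Finset.univ.filter fun x => f x = t).card

theorem fiberCard_pos [Fintype S] (f : S → T) (x : S) : 0 < fiberCard f (f x) :=
  Finset.card_pos.2 ⟨x, by simp⟩

theorem sum_dist_mul_comp [Fintype S] (X : Ω → S) (f : S → T) (F : T → ℝ) :
    ∑ x, dist p X x * F (f x)
      = ∑ t ∈ Finset.univ.image f, dist p (fun ω => f (X ω)) t * F t := by
  simp only [dist_comp p X f, Finset.sum_mul]
  rw [Finset.sum_comm]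
  refine Finset.sum_congr rfl fun x _ => ?_
  simp [ite_mul]

theorem sum_comp_div_fiberCard [Fintype S] (f : S → T) (F : T → ℝ) :
    ∑ x, (fiberCard f (f x) : ℝ)⁻¹ * F (f x) = ∑ t ∈ Finset.univ.image f, F t := by
  rw [← Finset.sum_fiberwise_of_maps_to (s := Finset.univ) (g := f)
    (fun x _ => Finset.mem_image_of_mem f (Finset.mem_univ x))]
  refine Finset.sum_congr rfl fun t ht => ?_
  obtain ⟨x, -, rfl⟩ := Finset.mem_image.1 ht
  rw [Finset.sum_congr rfl (g := fun _ => (fiberCard f (f x) : ℝ)⁻¹ * F (f x))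
    fun y hy => by rw [(Finset.mem_filter.1 hy).2], Finset.sum_const, nsmul_eq_mul]
  have := fiberCard_pos f x
  change (fiberCard f (f x) : ℝ) * _ = _
  field_simp

theorem condEntropy_of_uniform_on_fiber [Fintype S] (X Y : Ω → S) (f : S → T)
    (h : ∀ x y, dist p (fun ω => (X ω, Y ω)) (x, y)
      = if f x = f y then dist p X x * (fiberCard f (f y) : ℝ)⁻¹ else 0) :
    condEntropy p X Y = entropy p X - entropy p (fun ω => f (X ω)) := by
  have hY (y : S) :
      dist p Y y = (fiberCard f (f y) : ℝ)⁻¹ * dist p (fun ω => f (X ω)) (f y) := by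
    have := dist_comp p (fun ω => (X ω, Y ω)) Prod.snd y
    simp only at this
    rw [this, Fintype.sum_prod_type, dist_comp p X f, Finset.mul_sum]
    refine Finset.sum_congr rfl fun x _ => ?_
    simp [h, mul_comm]
  have hXY : entropy2 p X Y = entropy p X
      + ∑ x, dist p X x * Real.log (fiberCard f (f x)) := by
    rw [entropy2, entropy_eq_sum_of_forall_mem p _ Finset.univ (by simp),
      entropy_eq_sum_of_forall_mem p X Finset.univ (by simp), Fintype.sum_prod_type,
      ← Finset.sum_add_distrib]
    refine Finset.sum_congr rfl fun x _ => ?_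
    have hx := fiberCard_pos f x
    rw [Finset.sum_congr rfl (g := fun y => if f y = f x then
      Real.negMulLog (dist p X x * (fiberCard f (f x) : ℝ)⁻¹) else 0),
      ← Finset.sum_filter, Finset.sum_const, nsmul_eq_mul]
    · change (fiberCard f (f x) : ℝ) * _ = _
      rw [Real.negMulLog_mul, negMulLog_inv]
      field_simp
    · intro y _
      rw [h]
      by_cases hxy : f y = f x
      · simp [hxy]
      · simp [hxy, Ne.symm hxy]
  have hH : entropy p Y = entropy p (fun ω => f (X ω))
      + ∑ x, dist p X x * Real.log (fiberCard f (f x)) := by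
    rw [entropy_eq_sum_of_forall_mem p Y Finset.univ (by simp),
      entropy_eq_sum_of_forall_mem p (fun ω => f (X ω)) (Finset.univ.image f) (by simp),
      sum_dist_mul_comp p X f fun t => Real.log (fiberCard f t), ← Finset.sum_add_distrib,
      ← sum_comp_div_fiberCard]
    refine Finset.sum_congr rfl fun y _ => ?_
    rw [hY, Real.negMulLog_mul, negMulLog_inv]
    ring
  rw [condEntropy, hXY, hH]
  ring

end Entropy

section TwoStagePermutation

variable {B m : ℕ}

/-- The two-stage permutation of segment contents: within segments by `h.1`, then across segments
by `h.2`. -/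
def twoStagePerm (h : (Fin B → Equiv.Perm (Fin m)) × Equiv.Perm (Fin B))
    (x : Fin B → Finset (Fin m)) (j : Fin B) : Finset (Fin m) :=
  (x (h.2 j)).image ⇑(h.1 (h.2 j))⁻¹

/-- The multiset of segment sizes. -/
def sizeMultiset (x : Fin B → Finset (Fin m)) : Multiset ℕ :=
  Multiset.map (fun i => (x i).card) Finset.univ.val

theorem sizeMultiset_twoStagePerm (h : (Fin B → Equiv.Perm (Fin m)) × Equiv.Perm (Fin B))
    (x : Fin B → Finset (Fin m)) : sizeMultiset (twoStagePerm h x) = sizeMultiset x := by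
  have hc (j : Fin B) : (twoStagePerm h x j).card = (x (h.2 j)).card :=
    Finset.card_image_of_injective _ (Equiv.injective _)
  simp only [sizeMultiset, hc]
  conv_rhs => rw [← Multiset.map_univ_val_equiv h.2]
  rw [Multiset.map_map]
  rfl

theorem exists_perm_comp_eq_of_map_univ_eq {α β : Type*} [Fintype α] {f g : α → β}
    (h : Multiset.map f Finset.univ.val = Multiset.map g Finset.univ.val) :
    ∃ e : Equiv.Perm α, ∀ a, f (e a) = g a := by
  have hc (c : β) : Nonempty ({a // g a = c} ≃ {a // f a = c}) := by
    refine ⟨Fintype.equivOfCardEq ?_⟩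
    have := congrArg (Multiset.count c) h
    simp only [Multiset.count_map] at this
    rw [Fintype.card_subtype, Fintype.card_subtype, Finset.card_def, Finset.card_def,
      Finset.filter_val, Finset.filter_val]
    simpa only [eq_comm] using this.symm
  exact ⟨Equiv.ofFiberEquiv fun c => (hc c).some, Equiv.ofFiberEquiv_map _⟩

theorem exists_twoStagePerm_eq {x y : Fin B → Finset (Fin m)}
    (h : sizeMultiset x = sizeMultiset y) : ∃ k, twoStagePerm k x = y := by
  obtain ⟨e, he⟩ := exists_perm_comp_eq_of_map_univ_eq h
  choose ρ hρ using fun i : Fin B =>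
    Equiv.Perm.exists_map_finset_eq (x i) (y (e.symm i)) (by simpa using he (e.symm i))
  refine ⟨(fun i => (ρ i)⁻¹, e), funext fun j => ?_⟩
  have := hρ (e j)
  rw [Finset.map_eq_image, Equiv.symm_apply_apply] at this
  simpa [twoStagePerm] using this

theorem card_twoStagePerm_le (x y : Fin B → Finset (Fin m))
    (k : (Fin B → Equiv.Perm (Fin m)) × Equiv.Perm (Fin B)) :
    (Finset.univ.filter fun h => twoStagePerm h x = y).card
      ≤ (Finset.univ.filter fun h => twoStagePerm h x = twoStagePerm k y).card := by
  refine Finset.card_le_card_of_injOn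
    (fun h => (fun i => h.1 i * k.1 (h.2⁻¹ i), h.2 * k.2)) (fun h hh => ?_) fun h _ h' _ hh => ?_
  · obtain rfl := (Finset.mem_filter.1 hh).2
    refine Finset.mem_filter.2 ⟨Finset.mem_univ _, funext fun j => ?_⟩
    simp [twoStagePerm, Finset.image_image, Equiv.Perm.coe_mul, mul_inv_rev]
  · obtain ⟨h1, h2⟩ := Prod.ext_iff.1 hh
    have h2' : h.2 = h'.2 := mul_right_cancel h2
    refine Prod.ext (funext fun i => ?_) h2'
    have := congrFun h1 i
    simp only [h2'] at this
    exact mul_right_cancel this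

theorem card_twoStagePerm_eq (x y : Fin B → Finset (Fin m)) (h : sizeMultiset x = sizeMultiset y) :
    ((Finset.univ.filter fun k => twoStagePerm k x = y).card : ℝ)
      = Fintype.card ((Fin B → Equiv.Perm (Fin m)) × Equiv.Perm (Fin B))
        * (fiberCard (sizeMultiset (B := B) (m := m)) (sizeMultiset y) : ℝ)⁻¹ := by
  have hle (y z : Fin B → Finset (Fin m)) (hyz : sizeMultiset y = sizeMultiset z) :
      (Finset.univ.filter fun k => twoStagePerm k x = y).card
        ≤ (Finset.univ.filter fun k => twoStagePerm k x = z).card := by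
    obtain ⟨k, rfl⟩ := exists_twoStagePerm_eq hyz
    exact card_twoStagePerm_le x y k
  have hsum := Finset.card_eq_sum_card_fiberwise
    (s := (Finset.univ : Finset ((Fin B → Equiv.Perm (Fin m)) × Equiv.Perm (Fin B))))
    (f := fun k => twoStagePerm k x)
    (t := Finset.univ.filter fun z => sizeMultiset z = sizeMultiset y)
    (fun k _ => by simp [sizeMultiset_twoStagePerm, h])
  rw [Finset.sum_congr rfl fun z hz => le_antisymm (hle z y (Finset.mem_filter.1 hz).2)
    (hle y z (Finset.mem_filter.1 hz).2.symm), Finset.sum_const, smul_eq_mul,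
    Finset.card_univ] at hsum
  have hpos := fiberCard_pos (sizeMultiset (B := B) (m := m)) y
  have hfib : (Finset.univ.filter fun z : Fin B → Finset (Fin m) =>
      sizeMultiset z = sizeMultiset y).card
        = fiberCard (sizeMultiset (B := B) (m := m)) (sizeMultiset y) := by
    unfold fiberCard
    congr!
  rw [hfib] at hsum
  rw [hsum, Nat.cast_mul]
  field_simp

end TwoStagePermutation

/-- With both within-segment and inter-segment permutations
(cases 3 and 4), the conditional entropy of the real sparse index sets given
the permuted index sets satisfies `H(X | Y) = H(X) − H(M)`, where `M` is the
random multiset `{|X_1|, …, |X_B|}` of per-segment counts. -/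
theorem conditional_entropy_two_stage
    {Ω : Type*} [Fintype Ω] (p : Ω → ℝ)
    (hp0 : ∀ ω, 0 ≤ p ω) (hp1 : ∑ ω, p ω = 1)
    (B m s : ℕ) (hB : 0 < B) (hm : 0 < m) (hs : s ≤ B * m)
    (X : Ω → Fin B → Finset (Fin m))
    (hXs : ∀ ω, p ω ≠ 0 → ∑ i, (X ω i).card = s)
    (π : Fin B → Ω → Equiv.Perm (Fin m))
    (σ : Ω → Equiv.Perm (Fin B))
    (hπunif : ∀ i g, dist p (π i) g = (Fintype.card (Equiv.Perm (Fin m)) : ℝ)⁻¹)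
    (hσunif : ∀ τ, dist p σ τ = (Fintype.card (Equiv.Perm (Fin B)) : ℝ)⁻¹)
    (hindep : ∀ (x : Fin B → Finset (Fin m)) (g : Fin B → Equiv.Perm (Fin m))
        (τ : Equiv.Perm (Fin B)),
      pr p (fun ω => X ω = x ∧ (∀ i, π i ω = g i) ∧ σ ω = τ)
        = dist p X x * (∏ i, dist p (π i) (g i)) * dist p σ τ)
    (Y : Ω → Fin B → Finset (Fin m))
    (hY : ∀ ω j, Y ω j = (X ω (σ ω j)).image ⇑(π (σ ω j) ω)⁻¹)
    (M : Ω → Multiset ℕ)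
    (hM : ∀ ω, M ω = Multiset.map (fun i => (X ω i).card) Finset.univ.val) :
    condEntropy p X Y = entropy p X - entropy p M := by
  obtain rfl : M = fun ω => sizeMultiset (X ω) := funext hM
  refine condEntropy_of_uniform_on_fiber p X Y sizeMultiset fun x y => ?_
  have hZ (z : (Fin B → Finset (Fin m)) × (Fin B → Equiv.Perm (Fin m)) × Equiv.Perm (Fin B)) :
      dist p (fun ω => (X ω, (fun i => π i ω), σ ω)) z = dist p X z.1
        * (Fintype.card ((Fin B → Equiv.Perm (Fin m)) × Equiv.Perm (Fin B)) : ℝ)⁻¹ := by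
    have := hindep z.1 z.2.1 z.2.2
    simp only [hπunif, hσunif, Finset.prod_const, Finset.card_univ, Fintype.card_fin] at this
    rw [Fintype.card_prod, Fintype.card_fun, Fintype.card_fin, Nat.cast_mul, Nat.cast_pow, mul_inv,
      ← inv_pow, ← mul_assoc, ← this]
    simp only [_root_.dist, Prod.ext_iff, ← funext_iff]
  have hXY : (fun ω => (X ω, Y ω))
      = fun ω => (fun z : (Fin B → Finset (Fin m)) × (Fin B → Equiv.Perm (Fin m)) ×
        Equiv.Perm (Fin B) => (z.1, twoStagePerm z.2 z.1)) (X ω, (fun i => π i ω), σ ω) :=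
    funext fun ω => Prod.ext rfl (funext fun j => hY ω j)
  rw [hXY, dist_comp p (fun ω => (X ω, (fun i => π i ω), σ ω))
    (fun z => (z.1, twoStagePerm z.2 z.1)), Fintype.sum_prod_type, Finset.sum_eq_single x]
  · simp only [hZ, Prod.mk.injEq, true_and]
    rw [← Finset.sum_filter, Finset.sum_const, nsmul_eq_mul]
    split_ifs with h
    · rw [card_twoStagePerm_eq x y h]
      have : (Fintype.card ((Fin B → Equiv.Perm (Fin m)) × Equiv.Perm (Fin B)) : ℝ) ≠ 0 :=
        Nat.cast_ne_zero.2 Fintype.card_ne_zero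
      field_simp
    · rw [Finset.filter_false_of_mem, Finset.card_empty, Nat.cast_zero, zero_mul]
      rintro k - rfl
      exact h (sizeMultiset_twoStagePerm k x).symm
  · intro x' _ hx'
    simp [hx']
  · simp
end
end
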